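/- Suppose the sampling distribution p on [n]×[m] satisfies the marginal lower bounds p^r(i) ≥ 1/(C·n) for all i and p^c(j) ≥ 1/(C·m) for all j, for some constant C ≥ 1. Let X̂_S = argmin{L̂_S(X) : X ∈ W_p}. Then there is an absolute constant C' such that, in expectation over a training sample S of size s drawn i.i.d. from p, E_S[L_p(X̂_S)] ≤ inf_{X ∈ W_p} L_p(X) + C'·C · l · √(r·n·log(n)/s). -/

import Mathlib

open scoped Classical
open Matrix Finset

noncomputable section

/-- Trace norm (sum of singular values) of a real matrix. -/
def traceNorm {n m : ℕ} (X : Matrix (Fin n) (Fin m) ℝ) : ℝ :=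
  ∑ j, Real.sqrt ((Matrix.isHermitian_conjTranspose_mul_self X).eigenvalues j)

/-- Weighted trace norm with row weights `pr` and column weights `pc`. -/
def wTrNorm {n m : ℕ} (pr : Fin n → ℝ) (pc : Fin m → ℝ)
    (X : Matrix (Fin n) (Fin m) ℝ) : ℝ :=
  traceNorm (Matrix.diagonal (fun i => Real.sqrt (pr i)) * X *
    Matrix.diagonal (fun j => Real.sqrt (pc j)))

/-- Weighted trace-norm ball of radius `√r`. -/
def Wball {n m : ℕ} (pr : Fin n → ℝ) (pc : Fin m → ℝ) (r : ℝ) :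
    Set (Matrix (Fin n) (Fin m) ℝ) :=
  {X | wTrNorm pr pc X ≤ Real.sqrt r}

/-- Row marginals of a distribution on `[n] × [m]`. -/
def rowMarg {n m : ℕ} (p : Matrix (Fin n) (Fin m) ℝ) (i : Fin n) : ℝ := ∑ j, p i j

/-- Column marginals of a distribution on `[n] × [m]`. -/
def colMarg {n m : ℕ} (p : Matrix (Fin n) (Fin m) ℝ) (j : Fin m) : ℝ := ∑ i, p i j

/-- `p` is a probability distribution on `[n] × [m]`. -/
def IsDistrib {n m : ℕ} (p : Matrix (Fin n) (Fin m) ℝ) : Prop :=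
  (∀ i j, 0 ≤ p i j) ∧ ∑ i, ∑ j, p i j = 1

/-- `ℓ` is `l`-Lipschitz in its first argument. -/
def LipLoss (l : ℝ) (ℓ : ℝ → ℝ → ℝ) : Prop :=
  ∀ x x' y, |ℓ x y - ℓ x' y| ≤ l * |x - x'|

/-- Probability of drawing the i.i.d. sample `S` from `p`. -/
def sampleProb {n m s : ℕ} (p : Matrix (Fin n) (Fin m) ℝ)
    (S : Fin s → Fin n × Fin m) : ℝ :=
  ∏ t, p (S t).1 (S t).2

/-- Expectation over an i.i.d. sample of size `s` drawn from `p`. -/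
def Esample {n m : ℕ} (s : ℕ) (p : Matrix (Fin n) (Fin m) ℝ)
    (f : (Fin s → Fin n × Fin m) → ℝ) : ℝ :=
  ∑ S : Fin s → Fin n × Fin m, sampleProb p S * f S

/-- Empirical risk of `X` on the sample `S` (target matrix `Y`, loss `ℓ`). -/
def empRisk {n m s : ℕ} (ℓ : ℝ → ℝ → ℝ) (Y : Matrix (Fin n) (Fin m) ℝ)
    (S : Fin s → Fin n × Fin m) (X : Matrix (Fin n) (Fin m) ℝ) : ℝ :=
  (1 / (s : ℝ)) * ∑ t, ℓ (X (S t).1 (S t).2) (Y (S t).1 (S t).2)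

/-- Population risk of `X` under sampling distribution `p`. -/
def popRisk {n m : ℕ} (p : Matrix (Fin n) (Fin m) ℝ) (ℓ : ℝ → ℝ → ℝ)
    (Y X : Matrix (Fin n) (Fin m) ℝ) : ℝ :=
  ∑ i, ∑ j, p i j * ℓ (X i j) (Y i j)

def mx {ι : Type*} [Fintype ι] [Nonempty ι] (f : ι → ℝ) : ℝ := Finset.univ.sup' Finset.univ_nonempty f

lemma le_mx {ι : Type*} [Fintype ι] [Nonempty ι] (f : ι → ℝ) (x : ι) : f x ≤ mx f :=
  Finset.le_sup' f (Finset.mem_univ x)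

lemma mx_le {ι : Type*} [Fintype ι] [Nonempty ι] (f : ι → ℝ) (c : ℝ) (h : ∀ x, f x ≤ c) : mx f ≤ c :=
  Finset.sup'_le _ _ (fun x _ => h x)

lemma exists_mx {ι : Type*} [Fintype ι] [Nonempty ι] (f : ι → ℝ) : ∃ x, mx f = f x := by
  obtain ⟨x, _, hx⟩ := Finset.exists_mem_eq_sup' (Finset.univ_nonempty (α := ι)) f
  exact ⟨x, hx⟩

def sg (b : Bool) : ℝ := if b then 1 else -1

lemma sg_not (b : Bool) : sg (!b) = - sg b := by cases b <;> simp [sg]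
lemma sg_sq (b : Bool) : sg b * sg b = 1 := by cases b <;> simp [sg]

lemma contr_one {ι : Type*} [Fintype ι] [Nonempty ι] (g φ a : ι → ℝ) (l : ℝ)
    (h : ∀ x y, |φ x - φ y| ≤ l * |a x - a y|) :
    ∑ b : Bool, mx (fun x => g x + sg b * φ x) ≤ ∑ b : Bool, mx (fun x => g x + l * (sg b * a x)) := by
  simp only [Fintype.sum_bool, sg, if_true, Bool.false_eq_true, if_false]
  obtain ⟨x, hx⟩ := exists_mx (fun x => g x + 1 * φ x)
  obtain ⟨y, hy⟩ := exists_mx (fun x => g x + -1 * φ x)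
  rw [hx, hy]
  have h1 := le_mx (fun x => g x + l * (1 * a x))
  have h2 := le_mx (fun x => g x + l * (-1 * a x))
  have h3 := (le_abs_self _).trans (h x y)
  rcases abs_cases (a x - a y) with ⟨e, _⟩ | ⟨e, _⟩
  · have := h1 x; have := h2 y; rw [e] at h3; linarith
  · have := h1 y; have := h2 x; rw [e] at h3; linarith

lemma sum_cons {s : ℕ} (F : (Fin (s+1) → Bool) → ℝ) :
    ∑ ε, F ε = ∑ b : Bool, ∑ ε : Fin s → Bool, F (Fin.cons b ε) := by
  rw [← Fintype.sum_prod_type']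
  exact ((Fin.consEquiv (fun _ => Bool)).sum_comp F).symm

lemma contraction {ι : Type*} [Fintype ι] [Nonempty ι] (l : ℝ) : ∀ (s : ℕ) (φ a : Fin s → ι → ℝ)
    (_ : ∀ t x y, |φ t x - φ t y| ≤ l * |a t x - a t y|) (g : ι → ℝ),
    ∑ ε : Fin s → Bool, mx (fun x => g x + ∑ t, sg (ε t) * φ t x) ≤
    ∑ ε : Fin s → Bool, mx (fun x => g x + l * ∑ t, sg (ε t) * a t x) := by
  intro s
  induction s with
  | zero => intro φ a h g; simp
  | succ s ih =>
    intro φ a h g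
    rw [sum_cons, sum_cons]
    simp only [Fin.sum_univ_succ, Fin.cons_zero, Fin.cons_succ]
    calc _ = ∑ b : Bool, ∑ ε : Fin s → Bool, mx (fun x => (g x + sg b * φ 0 x) + ∑ t, sg (ε t) * φ t.succ x) := by
            simp only [add_assoc]
      _ ≤ ∑ b : Bool, ∑ ε : Fin s → Bool, mx (fun x => (g x + sg b * φ 0 x) + l * ∑ t, sg (ε t) * a t.succ x) :=
            Finset.sum_le_sum fun b _ => ih (fun t => φ t.succ) (fun t => a t.succ) (fun t => h t.succ) _
      _ = ∑ ε : Fin s → Bool, ∑ b : Bool, mx (fun x => (g x + l * ∑ t, sg (ε t) * a t.succ x) + sg b * φ 0 x) := by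
            rw [Finset.sum_comm]; simp only [add_right_comm]
      _ ≤ ∑ ε : Fin s → Bool, ∑ b : Bool, mx (fun x => (g x + l * ∑ t, sg (ε t) * a t.succ x) + l * (sg b * a 0 x)) :=
            Finset.sum_le_sum fun ε _ => contr_one _ _ _ l (h 0)
      _ = _ := by
            rw [Finset.sum_comm]
            refine Finset.sum_congr rfl fun b _ => Finset.sum_congr rfl fun ε _ => ?_
            congr 1; funext x; ring

def wt {α : Type*} {s : ℕ} (P : α → ℝ) (S : Fin s → α) : ℝ := ∏ t, P (S t)

lemma wt_nonneg {α : Type*} {s : ℕ} {P : α → ℝ} (hP : ∀ z, 0 ≤ P z) (S : Fin s → α) : 0 ≤ wt P S :=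
  Finset.prod_nonneg fun _ _ => hP _

lemma sum_prod_eq {α : Type*} [Fintype α] {s : ℕ} (h : Fin s → α → ℝ) :
    ∑ S : Fin s → α, ∏ t, h t (S t) = ∏ t, ∑ z, h t z := by
  rw [Finset.prod_univ_sum]; simp

lemma sum_wt {α : Type*} [Fintype α] {s : ℕ} {P : α → ℝ} (hP : ∑ z, P z = 1) :
    ∑ S : Fin s → α, wt P S = 1 := by
  unfold wt; rw [sum_prod_eq (fun _ => P)]; simp [hP]

lemma sum_wt_prod {α : Type*} [Fintype α] {s : ℕ} (P g : α → ℝ) :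
    ∑ S : Fin s → α, wt P S * ∏ t, g (S t) = (∑ z, P z * g z) ^ s := by
  simp only [wt, ← Finset.prod_mul_distrib]
  rw [sum_prod_eq (fun _ z => P z * g z)]; simp

lemma sum_wt_apply {α : Type*} [Fintype α] {s : ℕ} {P : α → ℝ} (hP : ∑ z, P z = 1) (f : α → ℝ) (t : Fin s) :
    ∑ S : Fin s → α, wt P S * f (S t) = ∑ z, P z * f z := by
  have : ∀ S : Fin s → α, wt P S * f (S t) = ∏ u, (P (S u) * if u = t then f (S u) else 1) := by
    intro S; rw [Finset.prod_mul_distrib, Finset.prod_ite_eq']; simp [wt]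
  simp only [this]
  rw [sum_prod_eq (fun u z => P z * if u = t then f z else 1)]
  rw [Finset.prod_eq_single t]
  · simp
  · intro b _ hb; simp [hb, hP]
  · simp

/-- swap -/
def sw {α : Type*} {s : ℕ} (ε : Fin s → Bool) (q : (Fin s → α) × (Fin s → α)) : (Fin s → α) × (Fin s → α) :=
  (fun t => if ε t then q.1 t else q.2 t, fun t => if ε t then q.2 t else q.1 t)

lemma sw_inv {α : Type*} {s : ℕ} (ε : Fin s → Bool) : Function.Involutive (sw (α := α) ε) := by
  intro q; unfold sw; ext t <;> cases h : ε t <;> simp [h]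

lemma sw_wt {α : Type*} {s : ℕ} (P : α → ℝ) (ε : Fin s → Bool) (q : (Fin s → α) × (Fin s → α)) :
    wt P (sw ε q).1 * wt P (sw ε q).2 = wt P q.1 * wt P q.2 := by
  simp only [wt, sw, ← Finset.prod_mul_distrib]
  refine Finset.prod_congr rfl fun t _ => ?_
  cases ε t <;> simp [mul_comm]

lemma symm_lemma {α ι : Type*} [Fintype α] [Fintype ι] [Nonempty ι] {s : ℕ} {P : α → ℝ}
    (hP0 : ∀ z, 0 ≤ P z) (hP : ∑ z, P z = 1) (f : ι → α → ℝ) (x : (Fin s → α) → ι) :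
    (2:ℝ)^s * ∑ S : Fin s → α, wt P S * (s * (∑ z, P z * f (x S) z) - ∑ t, f (x S) (S t)) ≤
     2 * ∑ S : Fin s → α, wt P S * ∑ ε : Fin s → Bool, mx (fun i => ∑ t, sg (ε t) * f i (S t)) := by
  have h1 : ∑ S : Fin s → α, wt P S * (s * (∑ z, P z * f (x S) z) - ∑ t, f (x S) (S t)) ≤
      ∑ q : (Fin s → α) × (Fin s → α), wt P q.1 * wt P q.2 * mx (fun i => ∑ t, (f i (q.1 t) - f i (q.2 t))) := by
    rw [Fintype.sum_prod_type_right]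
    refine Finset.sum_le_sum fun S _ => ?_
    have : (s * (∑ z, P z * f (x S) z) - ∑ t, f (x S) (S t)) =
       ∑ S' : Fin s → α, wt P S' * ∑ t, (f (x S) (S' t) - f (x S) (S t)) := by
      simp only [Finset.sum_sub_distrib, mul_sub]
      rw [← Finset.sum_mul, sum_wt hP, one_mul]
      congr 1
      simp only [Finset.mul_sum]
      rw [Finset.sum_comm]
      simp only [sum_wt_apply hP, Finset.sum_const, Finset.card_univ, Fintype.card_fin, nsmul_eq_mul]
      rw [Finset.mul_sum]
    rw [this, Finset.mul_sum]
    refine Finset.sum_le_sum fun S' _ => ?_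
    have := le_mx (fun i => ∑ t, (f i (S' t) - f i (S t))) (x S)
    have h0 := mul_nonneg (wt_nonneg hP0 S') (wt_nonneg hP0 S)
    have := mul_le_mul_of_nonneg_left this h0
    simp only at *
    linarith
  have h2 : ∀ ε : Fin s → Bool, ∑ q : (Fin s → α) × (Fin s → α), wt P q.1 * wt P q.2 * mx (fun i => ∑ t, (f i (q.1 t) - f i (q.2 t)))
     = ∑ q : (Fin s → α) × (Fin s → α), wt P q.1 * wt P q.2 * mx (fun i => ∑ t, sg (ε t) * (f i (q.1 t) - f i (q.2 t))) := by
    intro ε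
    rw [← Equiv.sum_comp (sw_inv (α := α) ε).toPerm]
    refine Finset.sum_congr rfl fun q _ => ?_
    simp only [Function.Involutive.coe_toPerm, sw_wt]
    congr 2; funext i
    refine Finset.sum_congr rfl fun t _ => ?_
    cases h : ε t <;> simp [sw, sg, h]
  have h3 : ∀ ε : Fin s → Bool, ∑ q : (Fin s → α) × (Fin s → α), wt P q.1 * wt P q.2 * mx (fun i => ∑ t, sg (ε t) * (f i (q.1 t) - f i (q.2 t)))
     ≤ ∑ S : Fin s → α, wt P S * (mx (fun i => ∑ t, sg (ε t) * f i (S t)) + mx (fun i => ∑ t, sg (!(ε t)) * f i (S t))) := by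
    intro ε
    have e : ∑ S : Fin s → α, wt P S * (mx (fun i => ∑ t, sg (ε t) * f i (S t)) + mx (fun i => ∑ t, sg (!(ε t)) * f i (S t)))
      = ∑ q : (Fin s → α) × (Fin s → α), wt P q.1 * wt P q.2 * (mx (fun i => ∑ t, sg (ε t) * f i (q.1 t)) + mx (fun i => ∑ t, sg (!(ε t)) * f i (q.2 t))) := by
      simp only [mul_add, Finset.sum_add_distrib]
      congr 1
      · rw [Fintype.sum_prod_type]
        refine Finset.sum_congr rfl fun S _ => ?_
        simp only [← Finset.sum_mul, ← Finset.mul_sum, sum_wt hP, mul_one]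
      · rw [Fintype.sum_prod_type_right]
        refine Finset.sum_congr rfl fun S _ => ?_
        simp only [← Finset.sum_mul, sum_wt hP, one_mul]
    rw [e]
    refine Finset.sum_le_sum fun q _ => mul_le_mul_of_nonneg_left ?_ (mul_nonneg (wt_nonneg hP0 _) (wt_nonneg hP0 _))
    refine mx_le _ _ fun i => ?_
    have a1 := le_mx (fun i => ∑ t, sg (ε t) * f i (q.1 t)) i
    have a2 := le_mx (fun i => ∑ t, sg (!(ε t)) * f i (q.2 t)) i
    simp only [sg_not, mul_sub, Finset.sum_sub_distrib, neg_mul, Finset.sum_neg_distrib] at *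
    linarith
  have h4 : (2:ℝ)^s * ∑ q : (Fin s → α) × (Fin s → α), wt P q.1 * wt P q.2 * mx (fun i => ∑ t, (f i (q.1 t) - f i (q.2 t)))
    ≤ ∑ ε : Fin s → Bool, ∑ S : Fin s → α, wt P S * (mx (fun i => ∑ t, sg (ε t) * f i (S t)) + mx (fun i => ∑ t, sg (!(ε t)) * f i (S t))) := by
    refine le_trans (le_of_eq ?_) (Finset.sum_le_sum fun ε _ => (h2 ε).le.trans (h3 ε))
    simp
  refine (mul_le_mul_of_nonneg_left h1 (by positivity)).trans (h4.trans (le_of_eq ?_))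
  rw [Finset.sum_comm, Finset.mul_sum]
  refine Finset.sum_congr rfl fun S _ => ?_
  rw [← Finset.mul_sum, Finset.sum_add_distrib]
  have inv : Function.Involutive (fun (ε : Fin s → Bool) t => !(ε t)) := by intro ε; simp
  have := Equiv.sum_comp inv.toPerm (fun ε : Fin s → Bool => mx (fun i => ∑ t, sg (ε t) * f i (S t)))
  simp only [Function.Involutive.coe_toPerm] at this
  rw [this]; ring

lemma spec {ι : Type*} [Fintype ι] [DecidableEq ι] (X : Matrix ι ι ℝ) (hX : Xᵀ = X) :
    ∃ (U : Matrix ι ι ℝ) (d : ι → ℝ), U * Uᵀ = 1 ∧ Uᵀ * U = 1 ∧ X = U * diagonal d * Uᵀ := by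
  have hH : X.IsHermitian := by rw [Matrix.IsHermitian, conjTranspose_eq_transpose_of_trivial]; exact hX
  refine ⟨hH.eigenvectorUnitary, hH.eigenvalues, ?_, ?_, ?_⟩
  · have := Unitary.mul_star_self_of_mem hH.eigenvectorUnitary.2
    rwa [star_eq_conjTranspose, conjTranspose_eq_transpose_of_trivial] at this
  · have := Unitary.star_mul_self_of_mem hH.eigenvectorUnitary.2
    rwa [star_eq_conjTranspose, conjTranspose_eq_transpose_of_trivial] at this
  · have := hH.spectral_theorem
    rw [Unitary.conjStarAlgAut_apply, star_eq_conjTranspose, conjTranspose_eq_transpose_of_trivial] at this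
    exact this

lemma spec_pow {ι : Type*} [Fintype ι] [DecidableEq ι] {X U : Matrix ι ι ℝ} {d : ι → ℝ}
    (h1 : U * Uᵀ = 1) (h2 : Uᵀ * U = 1) (hX : X = U * diagonal d * Uᵀ) (k : ℕ) :
    X ^ k = U * diagonal (fun i => d i ^ k) * Uᵀ := by
  induction k with
  | zero => simp [h1]
  | succ k ih =>
    rw [pow_succ, ih, hX]
    calc _ = U * diagonal (fun i => d i ^ k) * (Uᵀ * U) * diagonal d * Uᵀ := by simp only [Matrix.mul_assoc]
      _ = _ := by rw [h2, Matrix.mul_one, Matrix.mul_assoc U, diagonal_mul_diagonal]; simp only [pow_succ]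

lemma tr_form {ι : Type*} [Fintype ι] [DecidableEq ι] (B : Matrix ι ι ℝ) (d e : ι → ℝ) :
    trace (Bᵀ * diagonal d * B * diagonal e) = ∑ i, ∑ j, B i j ^ 2 * (d i * e j) := by
  simp only [trace, diag_apply, mul_diagonal]
  rw [Finset.sum_comm]
  refine Finset.sum_congr rfl fun j _ => ?_
  rw [Matrix.mul_apply, Finset.sum_mul]
  refine Finset.sum_congr rfl fun i _ => ?_
  rw [mul_diagonal, transpose_apply]; ring

lemma pow_mul_le {k q : ℕ} (hk : Even k) (hq : q ≤ k) (x y : ℝ) :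
    x ^ q * y ^ (k - q) ≤ x ^ k + y ^ k := by
  have e : k = q + (k - q) := by omega
  rw [← hk.pow_abs x, ← hk.pow_abs y]
  calc x ^ q * y ^ (k - q) ≤ |x ^ q * y ^ (k-q)| := le_abs_self _
    _ = |x| ^ q * |y| ^ (k-q) := by rw [abs_mul, abs_pow, abs_pow]
    _ ≤ _ := by
      rcases le_total |x| |y| with h | h
      · have : |x| ^ q * |y| ^ (k-q) ≤ |y| ^ q * |y| ^ (k-q) := by gcongr
        rw [← pow_add, ← e] at this
        have : 0 ≤ |x| ^ k := by positivity
        linarith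
      · have : |x| ^ q * |y| ^ (k-q) ≤ |x| ^ q * |x| ^ (k-q) := by gcongr
        rw [← pow_add, ← e] at this
        have : 0 ≤ |y| ^ k := by positivity
        linarith

lemma tr_ineq {ι : Type*} [Fintype ι] [DecidableEq ι] (A X Y : Matrix ι ι ℝ) (hA : Aᵀ = A)
    (hX : Xᵀ = X) (hY : Yᵀ = Y) {k q : ℕ} (hk : Even k) (hq : q ≤ k) :
    trace (A * X ^ q * A * Y ^ (k - q)) ≤ trace (A * A * X ^ k) + trace (A * A * Y ^ k) := by
  obtain ⟨U, d, hU1, hU2, hU⟩ := spec X hX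
  obtain ⟨V, e, hV1, hV2, hV⟩ := spec Y hY
  have key : ∀ a b : ℕ, trace (A * X ^ a * A * Y ^ b) =
      ∑ i, ∑ j, (Uᵀ * A * V) i j ^ 2 * (d i ^ a * e j ^ b) := by
    intro a b
    rw [← tr_form, spec_pow hU1 hU2 hU, spec_pow hV1 hV2 hV]
    simp only [transpose_mul, transpose_transpose, hA]
    rw [← Matrix.mul_assoc, trace_mul_comm]
    simp only [Matrix.mul_assoc]
  have e1 : trace (A * A * X ^ k) = trace (A * X ^ k * A * Y ^ 0) := by
    rw [pow_zero, Matrix.mul_one, trace_mul_comm (A * X^k) A, Matrix.mul_assoc]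
  have e2 : trace (A * A * Y ^ k) = trace (A * X ^ 0 * A * Y ^ k) := by
    rw [pow_zero, Matrix.mul_one]
  rw [e1, e2, key, key, key, ← Finset.sum_add_distrib]
  refine Finset.sum_le_sum fun i _ => ?_
  rw [← Finset.sum_add_distrib]
  refine Finset.sum_le_sum fun j _ => ?_
  rw [← mul_add]
  refine mul_le_mul_of_nonneg_left ?_ (sq_nonneg _)
  simpa using pow_mul_le hk hq (d i) (e j)

lemma telescope {R : Type*} [Ring R] (X Y : R) (N : ℕ) :
    X ^ (N+1) - Y ^ (N+1) = ∑ q ∈ Finset.range (N+1), X ^ q * (X - Y) * Y ^ (N - q) := by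
  induction N with
  | zero => simp
  | succ N ih =>
    rw [Finset.sum_range_succ']
    have : ∑ q ∈ Finset.range (N+1), X ^ (q+1) * (X - Y) * Y ^ (N + 1 - (q+1)) =
        X * ∑ q ∈ Finset.range (N+1), X ^ q * (X - Y) * Y ^ (N - q) := by
      rw [Finset.mul_sum]
      refine Finset.sum_congr rfl fun q _ => ?_
      rw [Nat.add_sub_add_right, pow_succ']; simp only [mul_assoc]
    rw [this, ← ih]
    simp only [pow_zero, one_mul, Nat.sub_zero]
    rw [pow_succ' X (N+1), pow_succ' Y (N+1)]; noncomm_ring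

/-- Rademacher series -/
def rs {ι : Type*} {s : ℕ} (A : Fin s → Matrix ι ι ℝ) (ε : Fin s → Bool) : Matrix ι ι ℝ :=
  ∑ t, sg (ε t) • A t

lemma rs_symm {ι : Type*} {s : ℕ} {A : Fin s → Matrix ι ι ℝ} (hA : ∀ t, (A t)ᵀ = A t) (ε : Fin s → Bool) :
    (rs A ε)ᵀ = rs A ε := by
  simp [rs, Matrix.transpose_sum, hA]

def fl {s : ℕ} (t : Fin s) (ε : Fin s → Bool) : Fin s → Bool := Function.update ε t (!(ε t))

lemma fl_inv {s : ℕ} (t : Fin s) : Function.Involutive (fl t) := by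
  intro ε; simp [fl]

lemma rs_fl {ι : Type*} {s : ℕ} (A : Fin s → Matrix ι ι ℝ) (ε : Fin s → Bool) (t : Fin s) :
    rs A ε - rs A (fl t ε) = (2 * sg (ε t)) • A t := by
  unfold rs
  rw [← Finset.sum_sub_distrib, Finset.sum_eq_single t]
  · simp [fl, sg_not, ← two_smul ℝ (sg (ε t) • A t), smul_smul]
  · intro b _ hb; simp [fl, hb]
  · simp

lemma sum_fl {s : ℕ} (t : Fin s) (F : (Fin s → Bool) → ℝ) : ∑ ε, F (fl t ε) = ∑ ε, F ε :=
  Equiv.sum_comp (fl_inv t).toPerm F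

lemma khin_step {ι : Type*} [Fintype ι] [DecidableEq ι] {s : ℕ} (A : Fin s → Matrix ι ι ℝ)
    (hA : ∀ t, (A t)ᵀ = A t) {k : ℕ} (hk : Even k) :
    ∑ ε, trace (rs A ε ^ (k + 2)) ≤ 2 * (k+1) * ∑ ε, trace ((∑ t, A t * A t) * rs A ε ^ k) := by
  have h1 : ∀ ε, trace (rs A ε ^ (k+2)) = ∑ t, sg (ε t) * trace (A t * rs A ε ^ (k+1)) := by
    intro ε
    rw [pow_succ' _ (k+1)]
    conv_lhs => rw [show rs A ε * rs A ε ^ (k+1) = (∑ t, sg (ε t) • A t) * rs A ε ^ (k+1) from rfl]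
    rw [Finset.sum_mul, trace_sum]
    simp
  have h2 : ∀ t, ∑ ε, sg (ε t) * trace (A t * rs A ε ^ (k+1)) =
      (1/2) * ∑ ε, sg (ε t) * trace (A t * (rs A ε ^ (k+1) - rs A (fl t ε) ^ (k+1))) := by
    intro t
    have := sum_fl t (fun ε => sg (ε t) * trace (A t * rs A ε ^ (k+1)))
    have e : ∀ ε, sg (fl t ε t) = - sg (ε t) := by intro ε; simp [fl, sg_not]
    simp only [e] at this
    simp only [mul_sub, trace_sub, Finset.sum_sub_distrib]
    simp only [neg_mul, Finset.sum_neg_distrib] at this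
    linarith
  have h3 : ∀ t ε, sg (ε t) * trace (A t * (rs A ε ^ (k+1) - rs A (fl t ε) ^ (k+1))) ≤
      2 * (k+1) * (trace (A t * A t * rs A ε ^ k) + trace (A t * A t * rs A (fl t ε) ^ k)) := by
    intro t ε
    rw [telescope, rs_fl, Finset.mul_sum, trace_sum, Finset.mul_sum]
    have : ∀ q ∈ Finset.range (k+1), sg (ε t) * trace (A t * (rs A ε ^ q * ((2 * sg (ε t)) • A t) * rs A (fl t ε) ^ (k - q)))
       ≤ 2 * (trace (A t * A t * rs A ε ^ k) + trace (A t * A t * rs A (fl t ε) ^ k)) := by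
      intro q hq
      have hq' : q ≤ k := by simp at hq; omega
      have e : sg (ε t) * trace (A t * (rs A ε ^ q * ((2 * sg (ε t)) • A t) * rs A (fl t ε) ^ (k - q)))
         = 2 * trace (A t * rs A ε ^ q * A t * rs A (fl t ε) ^ (k - q)) := by
        simp only [Matrix.mul_smul, Matrix.smul_mul, trace_smul, smul_eq_mul, Matrix.mul_assoc]
        have := sg_sq (ε t)
        linear_combination (2 * trace (A t * (rs A ε ^ q * (A t * rs A (fl t ε) ^ (k - q))))) * this
      rw [e]
      have := tr_ineq (A t) (rs A ε) (rs A (fl t ε)) (hA t) (rs_symm hA _) (rs_symm hA _) hk hq'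
      linarith
    refine (Finset.sum_le_sum this).trans (le_of_eq ?_)
    simp; ring
  simp only [h1]
  rw [Finset.sum_comm]
  simp only [h2, Finset.sum_mul, trace_sum]
  rw [Finset.sum_comm (s := Finset.univ (α := Fin s → Bool)), Finset.mul_sum]
  refine Finset.sum_le_sum fun t _ => ?_
  have h4 := Finset.sum_le_sum fun ε (_ : ε ∈ Finset.univ) => h3 t ε
  have h5 := sum_fl t (fun ε => trace (A t * A t * rs A ε ^ k))
  rw [← Finset.mul_sum, Finset.sum_add_distrib, h5] at h4
  linarith

lemma diag_pow_nonneg {ι : Type*} [Fintype ι] [DecidableEq ι] (X : Matrix ι ι ℝ) (hX : Xᵀ = X) {k : ℕ} (hk : Even k) (i : ι) :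
    0 ≤ (X ^ k) i i := by
  obtain ⟨q, rfl⟩ := hk
  rw [pow_add, Matrix.mul_apply]
  refine Finset.sum_nonneg fun j _ => ?_
  have : (X ^ q)ᵀ = X ^ q := by rw [transpose_pow, hX]
  rw [← this, transpose_apply, this]
  exact mul_self_nonneg _

lemma khin {ι : Type*} [Fintype ι] [DecidableEq ι] {s : ℕ} (A : Fin s → Matrix ι ι ℝ)
    (hA : ∀ t, (A t)ᵀ = A t) (D : ι → ℝ) (hD : ∑ t, A t * A t = diagonal D) (G : ℝ) (hG0 : 0 ≤ G) (hG : ∀ i, D i ≤ G)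
    (p : ℕ) : ∀ q, q ≤ p → ∑ ε, trace (rs A ε ^ (2 * q)) ≤ 2 ^ s * (Fintype.card ι * (4 * p * G) ^ q) := by
  intro q
  induction q with
  | zero => intro _; simp [trace_one]
  | succ q ih =>
    intro hq
    have ih := ih (by omega)
    have h := khin_step A hA (k := 2 * q) (even_two_mul q)
    rw [show 2 * (q+1) = 2 * q + 2 by ring]
    refine h.trans ?_
    have h1 : ∀ ε, 0 ≤ trace (rs A ε ^ (2*q)) := fun ε =>
      Finset.sum_nonneg fun i _ => diag_pow_nonneg _ (rs_symm hA ε) (even_two_mul q) i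
    have h2 : ∀ ε, trace ((∑ t, A t * A t) * rs A ε ^ (2*q)) ≤ G * trace (rs A ε ^ (2*q)) := by
      intro ε
      rw [hD]
      simp only [trace, diag_apply, diagonal_mul, Finset.mul_sum]
      exact Finset.sum_le_sum fun i _ => mul_le_mul_of_nonneg_right (hG i) (diag_pow_nonneg _ (rs_symm hA ε) (even_two_mul q) i)
    have h3 := Finset.sum_le_sum fun ε (_ : ε ∈ Finset.univ) => h2 ε
    rw [← Finset.mul_sum] at h3
    have h4 : (2 * (((2 * q : ℕ) : ℝ) + 1)) ≤ 4 * p := by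
      have : (q : ℝ) + 1 ≤ p := by exact_mod_cast hq
      push_cast; linarith
    have h5 : 0 ≤ ∑ ε, trace (rs A ε ^ (2*q)) := Finset.sum_nonneg fun ε _ => h1 ε
    calc _ ≤ 2 * (((2 * q : ℕ) : ℝ) + 1) * (G * ∑ ε, trace (rs A ε ^ (2*q))) :=
            mul_le_mul_of_nonneg_left h3 (by positivity)
      _ ≤ (4 * p) * (G * ∑ ε, trace (rs A ε ^ (2*q))) := mul_le_mul_of_nonneg_right h4 (mul_nonneg hG0 h5)
      _ ≤ (4 * p) * (G * (2 ^ s * (Fintype.card ι * (4 * p * G) ^ q))) := by gcongr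
      _ = _ := by ring

/-- bilinear form bound -/
lemma bilin {ι : Type*} [Fintype ι] [DecidableEq ι] (X : Matrix ι ι ℝ) (hX : Xᵀ = X) (a : ℝ) (ha : 0 < a) (p : ℕ)
    (hp : 1 ≤ p) (x y : ι → ℝ) :
    x ⬝ᵥ (X *ᵥ y) ≤ a * (1 + trace (X ^ (2*p)) / a ^ (2*p)) * (√(x ⬝ᵥ x) * √(y ⬝ᵥ y)) := by
  obtain ⟨U, d, h1, h2, h3⟩ := spec X hX
  set M := a * (1 + trace (X ^ (2*p)) / a ^ (2*p)) with hM
  have htr : trace (X ^ (2*p)) = ∑ i, d i ^ (2*p) := by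
    rw [spec_pow h1 h2 h3, trace_mul_comm, ← Matrix.mul_assoc, h2, Matrix.one_mul, trace_diagonal]
  have hd : ∀ i, |d i| ≤ M := by
    intro i
    have h5 : |d i| ^ (2*p) ≤ trace (X ^ (2*p)) := by
      rw [htr, (even_two_mul p).pow_abs]
      exact Finset.single_le_sum (f := fun i => d i ^ (2*p)) (fun j _ => (even_two_mul p).pow_nonneg _) (Finset.mem_univ i)
    have h6 : |d i| / a ≤ 1 + (|d i| / a) ^ (2*p) := by
      rcases le_total (|d i| / a) 1 with h | h
      · have : 0 ≤ (|d i| / a) ^ (2*p) := by positivity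
        linarith
      · have := le_self_pow₀ h (show 2 * p ≠ 0 by omega)
        linarith
    rw [div_pow] at h6
    have h7 : |d i| ^ (2*p) / a ^ (2*p) ≤ trace (X ^ (2*p)) / a ^ (2*p) := by gcongr
    have h8 := (div_le_iff₀ ha).1 (h6.trans (add_le_add_right h7 1))
    rw [hM]; linarith
  have hn : ∀ z : ι → ℝ, (Uᵀ *ᵥ z) ⬝ᵥ (Uᵀ *ᵥ z) = z ⬝ᵥ z := by
    intro z
    rw [dotProduct_mulVec, ← mulVec_transpose, transpose_transpose, mulVec_mulVec, h1, one_mulVec]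
  have e : x ⬝ᵥ (X *ᵥ y) = ∑ i, (Uᵀ *ᵥ x) i * (d i * (Uᵀ *ᵥ y) i) := by
    rw [h3, ← mulVec_mulVec, ← mulVec_mulVec, dotProduct_mulVec, ← mulVec_transpose]
    simp [dotProduct, mulVec_diagonal]
  rw [e, ← hn x, ← hn y]
  set u := Uᵀ *ᵥ x
  set v := Uᵀ *ᵥ y
  calc ∑ i, u i * (d i * v i) ≤ ∑ i, M * (|u i| * |v i|) := by
        refine Finset.sum_le_sum fun i _ => ?_
        calc _ ≤ |u i * (d i * v i)| := le_abs_self _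
          _ = |d i| * (|u i| * |v i|) := by rw [abs_mul, abs_mul]; ring
          _ ≤ _ := mul_le_mul_of_nonneg_right (hd i) (by positivity)
    _ = M * ∑ i, |u i| * |v i| := by rw [Finset.mul_sum]
    _ ≤ M * (√(u ⬝ᵥ u) * √(v ⬝ᵥ v)) := by
        have hM0 : 0 ≤ M := by
          have : 0 ≤ trace (X ^ (2*p)) := by rw [htr]; exact Finset.sum_nonneg fun j _ => (even_two_mul p).pow_nonneg _
          rw [hM]; positivity
        refine mul_le_mul_of_nonneg_left ?_ hM0
        have := Real.sum_mul_le_sqrt_mul_sqrt Finset.univ (fun i => |u i|) (fun i => |v i|)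
        simpa [dotProduct, sq_abs, pow_two] using this

lemma duality {n m : ℕ} (Q X : Matrix (Fin n) (Fin m) ℝ) (M : ℝ)
    (hQ : ∀ u v, u ⬝ᵥ (Q *ᵥ v) ≤ M * (√(u ⬝ᵥ u) * √(v ⬝ᵥ v))) :
    ∑ i, ∑ j, Q i j * X i j ≤ M * traceNorm X := by
  unfold traceNorm
  set hH := Matrix.isHermitian_conjTranspose_mul_self X
  set V : Matrix (Fin m) (Fin m) ℝ := hH.eigenvectorUnitary.1 with hV
  have h1 : V * Vᵀ = 1 := by
    have := Unitary.mul_star_self_of_mem hH.eigenvectorUnitary.2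
    rwa [star_eq_conjTranspose, conjTranspose_eq_transpose_of_trivial V] at this
  have h2 : Vᵀ * V = 1 := by
    have := Unitary.star_mul_self_of_mem hH.eigenvectorUnitary.2
    rwa [star_eq_conjTranspose, conjTranspose_eq_transpose_of_trivial V] at this
  have h3 : Xᵀ * X = V * diagonal hH.eigenvalues * Vᵀ := by
    have := hH.spectral_theorem
    rw [Unitary.conjStarAlgAut_apply, star_eq_conjTranspose] at this
    rw [← conjTranspose_eq_transpose_of_trivial V, ← conjTranspose_eq_transpose_of_trivial X]
    exact this
  have h4 : (X * V)ᵀ * (X * V) = diagonal hH.eigenvalues := by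
    rw [transpose_mul, Matrix.mul_assoc, ← Matrix.mul_assoc Xᵀ, h3]
    calc _ = (Vᵀ * V) * diagonal hH.eigenvalues * (Vᵀ * V) := by simp only [Matrix.mul_assoc]
      _ = _ := by rw [h2, Matrix.one_mul, Matrix.mul_one]
  have h5 : ∑ i, ∑ j, Q i j * X i j = ∑ j, (fun i => (X * V) i j) ⬝ᵥ (Q *ᵥ (fun i => V i j)) := by
    have a : ∑ i, ∑ j, Q i j * X i j = trace (Xᵀ * Q) := by
      simp only [trace, diag_apply, Matrix.mul_apply, transpose_apply]
      rw [Finset.sum_comm]; simp only [mul_comm]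
    have b : trace (Xᵀ * Q) = trace ((X * V)ᵀ * (Q * V)) := by
      rw [transpose_mul, Matrix.mul_assoc, trace_mul_comm Vᵀ, Matrix.mul_assoc, Matrix.mul_assoc, h1, Matrix.mul_one]
    rw [a, b]
    rfl
  rw [h5, Finset.mul_sum]
  refine Finset.sum_le_sum fun j _ => ?_
  refine (hQ _ _).trans (le_of_eq ?_)
  have a : (fun i => (X * V) i j) ⬝ᵥ (fun i => (X * V) i j) = hH.eigenvalues j := by
    have := congrFun (congrFun h4 j) j
    rw [diagonal_apply_eq] at this
    rw [← this]; rfl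
  have b : (fun i => V i j) ⬝ᵥ (fun i => V i j) = 1 := by
    have := congrFun (congrFun h2 j) j
    rw [one_apply_eq] at this
    rw [← this]; rfl
  rw [a, b]; simp

/-- dilation of a scaled elementary matrix -/
def dil {n m : ℕ} (w : Fin n × Fin m → ℝ) (z : Fin n × Fin m) :
    Matrix (Fin n ⊕ Fin m) (Fin n ⊕ Fin m) ℝ :=
  w z • (Matrix.single (Sum.inl z.1) (Sum.inr z.2) 1 + Matrix.single (Sum.inr z.2) (Sum.inl z.1) 1)

def zz {n m : ℕ} (w : Fin n × Fin m → ℝ) (a : Fin n ⊕ Fin m) (z : Fin n × Fin m) : ℝ :=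
  w z ^ 2 * ((if Sum.inl z.1 = a then 1 else 0) + (if Sum.inr z.2 = a then 1 else 0))

lemma dil_symm {n m : ℕ} (w : Fin n × Fin m → ℝ) (z : Fin n × Fin m) : (dil w z)ᵀ = dil w z := by
  simp [dil, add_comm]

lemma dil_sq {n m : ℕ} (w : Fin n × Fin m → ℝ) (z : Fin n × Fin m) :
    dil w z * dil w z = diagonal (fun a => zz w a z) := by
  have : dil w z * dil w z = (w z ^ 2) • (Matrix.single (Sum.inl z.1) (Sum.inl z.1) 1 + Matrix.single (Sum.inr z.2) (Sum.inr z.2) 1) := by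
    simp [dil, Matrix.mul_add, Matrix.add_mul, smul_smul, pow_two, add_comm]
  rw [this]
  ext a b
  simp only [Matrix.smul_apply, Matrix.add_apply, Matrix.single_apply, diagonal_apply, zz, smul_eq_mul]
  by_cases h : a = b
  · subst h; simp
  · simp only [h, if_false]
    have h1 : ¬ (Sum.inl z.1 = a ∧ Sum.inl z.1 = b) := fun ⟨x, y⟩ => h (x.symm.trans y)
    have h2 : ¬ (Sum.inr z.2 = a ∧ Sum.inr z.2 = b) := fun ⟨x, y⟩ => h (x.symm.trans y)
    simp [h1, h2]

lemma rad {n m s : ℕ} (w : Fin n × Fin m → ℝ) (S : Fin s → Fin n × Fin m) (G : ℝ) (hG : 0 < G)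
    (hGS : ∀ a, ∑ t, zz w a (S t) ≤ G) (p : ℕ) (hp : 1 ≤ p) (hnp : (n:ℝ) + m ≤ Real.exp p) :
    ∃ M : (Fin s → Bool) → ℝ, (∀ ε, 0 ≤ M ε) ∧ ∑ ε, M ε ≤ 2 ^ s * (2 * √(12 * p * G)) ∧
      ∀ ε (X : Matrix (Fin n) (Fin m) ℝ),
        ∑ t, sg (ε t) * (w (S t) * X (S t).1 (S t).2) ≤ M ε * traceNorm X := by
  set A : Fin s → Matrix (Fin n ⊕ Fin m) (Fin n ⊕ Fin m) ℝ := fun t => dil w (S t)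
  have hA : ∀ t, (A t)ᵀ = A t := fun t => dil_symm _ _
  have hp' : (1:ℝ) ≤ p := by exact_mod_cast hp
  set a := √(12 * p * G) with ha
  have ha0 : 0 < a := Real.sqrt_pos.2 (by positivity)
  have ha2 : a ^ 2 = 12 * p * G := Real.sq_sqrt (by positivity)
  have htr : ∀ ε, 0 ≤ trace (rs A ε ^ (2*p)) := fun ε =>
      Finset.sum_nonneg fun i _ => diag_pow_nonneg _ (rs_symm hA ε) (even_two_mul p) i
  have hM0 : ∀ ε, 0 ≤ a * (1 + trace (rs A ε ^ (2*p)) / a ^ (2*p)) := by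
    intro ε; have := htr ε; positivity
  refine ⟨fun ε => a * (1 + trace (rs A ε ^ (2*p)) / a ^ (2*p)), hM0, ?_, ?_⟩
  · have hk := khin A hA (fun a => ∑ t, zz w a (S t)) (by
      simp only [A, dil_sq]
      ext i j
      simp only [Matrix.sum_apply, diagonal_apply]
      by_cases h : i = j <;> simp [h]) G hG.le hGS p p le_rfl
    have h2 : ((Fintype.card (Fin n ⊕ Fin m) : ℕ) : ℝ) * (4 * p * G) ^ p ≤ a ^ (2 * p) := by
      rw [pow_mul, ha2]
      have : (12 * (p:ℝ) * G) = 3 * (4 * p * G) := by ring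
      rw [this, mul_pow 3]
      refine mul_le_mul_of_nonneg_right ?_ (by positivity)
      simp only [Fintype.card_sum, Fintype.card_fin, Nat.cast_add]
      refine hnp.trans ?_
      have : Real.exp p = Real.exp 1 ^ p := by rw [← Real.exp_nat_mul, mul_one]
      rw [this]
      exact pow_le_pow_left₀ (Real.exp_pos _).le (by have := Real.exp_one_lt_d9; linarith) _
    rw [← Finset.mul_sum, Finset.sum_add_distrib, ← Finset.sum_div]
    have h3 : (∑ ε, trace (rs A ε ^ (2*p))) / a ^ (2*p) ≤ 2 ^ s := by
      rw [div_le_iff₀ (by positivity)]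
      exact hk.trans (mul_le_mul_of_nonneg_left h2 (by positivity))
    have h4 : ∑ ε : Fin s → Bool, (1:ℝ) = 2 ^ s := by simp
    rw [h4]
    nlinarith
  · intro ε X
    set Q : Matrix (Fin n) (Fin m) ℝ := ∑ t, sg (ε t) • w (S t) • Matrix.single (S t).1 (S t).2 1 with hQ
    have h1 := duality Q X (a * (1 + trace (rs A ε ^ (2*p)) / a ^ (2*p))) (by
      intro u v
      have h := bilin (rs A ε) (rs_symm hA ε) a ha0 p hp (Sum.elim u 0) (Sum.elim 0 v)
      have e1 : (Sum.elim u 0 : Fin n ⊕ Fin m → ℝ) ⬝ᵥ Sum.elim u 0 = u ⬝ᵥ u := by simp [dotProduct]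
      have e2 : (Sum.elim 0 v : Fin n ⊕ Fin m → ℝ) ⬝ᵥ Sum.elim 0 v = v ⬝ᵥ v := by simp [dotProduct]
      rw [e1, e2] at h
      refine le_trans (le_of_eq ?_) h
      simp only [rs, hQ, A, dil, Matrix.sum_mulVec, dotProduct_sum, smul_mulVec, dotProduct_smul, Matrix.add_mulVec]
      refine Finset.sum_congr rfl fun t _ => ?_
      simp [dotProduct, Matrix.single_mulVec, Function.update_apply])
    refine le_trans (le_of_eq ?_) h1
    simp only [hQ, Matrix.sum_apply, Finset.sum_mul, Matrix.smul_apply, smul_eq_mul]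
    have : ∀ i, ∑ j, ∑ t, sg (ε t) * (w (S t) * Matrix.single (S t).1 (S t).2 (1:ℝ) i j) * X i j
       = ∑ t, ∑ j, sg (ε t) * (w (S t) * Matrix.single (S t).1 (S t).2 (1:ℝ) i j) * X i j := fun i => Finset.sum_comm
    simp only [this]
    rw [Finset.sum_comm]
    refine Finset.sum_congr rfl fun t _ => ?_
    rw [Finset.sum_eq_single (S t).1, Finset.sum_eq_single (S t).2]
    · simp; ring
    · intro b _ hb; simp [Matrix.single_apply, Ne.symm hb]
    · simp
    · intro b _ hb; refine Finset.sum_eq_zero fun j _ => ?_; simp [Matrix.single_apply, Ne.symm hb]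
    · simp

lemma chernoff {α κ : Type*} [Fintype α] [Fintype κ] [Nonempty κ] (s : ℕ) {P : α → ℝ} (hP0 : ∀ z, 0 ≤ P z)
    (hP : ∑ z, P z = 1) (f : κ → α → ℝ) (B μ : ℝ) (hB : 0 < B) (hμ : 0 ≤ μ) (hf0 : ∀ a z, 0 ≤ f a z)
    (hfB : ∀ a z, f a z ≤ B) (hfμ : ∀ a, ∑ z, P z * f a z ≤ μ) :
    ∃ G : (Fin s → α) → ℝ, (∀ S, 0 < G S) ∧ (∀ S a, ∑ t, f a (S t) ≤ G S) ∧
      ∑ S, wt P S * G S ≤ B * (Real.log (Fintype.card κ) + 2 * s * (μ / B) + 1) := by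
  set d : ℝ := ((Fintype.card κ : ℕ) : ℝ) with hd
  have hd1 : 1 ≤ d := by
    have : 1 ≤ Fintype.card κ := Fintype.card_pos
    rw [hd]; exact_mod_cast this
  set K := d * Real.exp (2 * s * (μ/B)) with hK
  have hK0 : 0 < K := by positivity
  have hlK : Real.log K = Real.log d + 2 * s * (μ/B) := by
    rw [hK, Real.log_mul (by positivity) (Real.exp_pos _).ne', Real.log_exp]
  have hlK0 : 0 ≤ Real.log K := by
    rw [hlK]; have := Real.log_nonneg hd1; positivity
  have hpos : ∀ S : Fin s → α, 0 < ∑ a, Real.exp ((∑ t, f a (S t)) / B) := fun S =>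
    Finset.sum_pos (fun a _ => Real.exp_pos _) Finset.univ_nonempty
  refine ⟨fun S => B * (Real.log K + (∑ a, Real.exp ((∑ t, f a (S t)) / B)) / K), ?_, ?_, ?_⟩
  · intro S; have := hpos S; positivity
  · intro S a
    have h1 : Real.exp ((∑ t, f a (S t)) / B) ≤ ∑ a, Real.exp ((∑ t, f a (S t)) / B) :=
      Finset.single_le_sum (f := fun a => Real.exp ((∑ t, f a (S t)) / B)) (fun _ _ => (Real.exp_pos _).le) (Finset.mem_univ a)
    have h2 := Real.add_one_le_exp ((∑ t, f a (S t)) / B - Real.log K)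
    rw [Real.exp_sub, Real.exp_log hK0] at h2
    have h3 := div_le_div_of_nonneg_right h1 hK0.le
    have h4 : (∑ t, f a (S t)) / B ≤ Real.log K + (∑ a, Real.exp ((∑ t, f a (S t)) / B)) / K := by linarith
    rw [div_le_iff₀ hB] at h4
    linarith
  · have h1 : ∀ a, ∑ S : Fin s → α, wt P S * Real.exp ((∑ t, f a (S t)) / B) ≤ Real.exp (2 * s * (μ/B)) := by
      intro a
      have e : ∀ S : Fin s → α, Real.exp ((∑ t, f a (S t)) / B) = ∏ t, Real.exp (f a (S t) / B) := by
        intro S; rw [Finset.sum_div, Real.exp_sum]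
      simp only [e]
      rw [sum_wt_prod P (fun z => Real.exp (f a z / B))]
      have h2 : ∑ z, P z * Real.exp (f a z / B) ≤ Real.exp (2 * (μ / B)) := by
        have : ∀ z, P z * Real.exp (f a z / B) ≤ P z + 2 / B * (P z * f a z) := by
          intro z
          have x0 : 0 ≤ f a z / B := div_nonneg (hf0 a z) hB.le
          have x1 : f a z / B ≤ 1 := (div_le_one hB).2 (hfB a z)
          have h3 := (le_abs_self _).trans (Real.abs_exp_sub_one_sub_id_le (x := f a z / B) (by rw [abs_of_nonneg x0]; exact x1))
          have h4 : Real.exp (f a z / B) ≤ 1 + 2 * (f a z / B) := by nlinarith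
          calc _ ≤ P z * (1 + 2 * (f a z / B)) := mul_le_mul_of_nonneg_left h4 (hP0 z)
            _ = _ := by ring
        refine (Finset.sum_le_sum fun z _ => this z).trans ?_
        rw [Finset.sum_add_distrib, hP, ← Finset.mul_sum]
        have h5 : 2 / B * ∑ z, P z * f a z ≤ 2 / B * μ := mul_le_mul_of_nonneg_left (hfμ a) (by positivity)
        have h6 := Real.add_one_le_exp (2 * (μ / B))
        have : 2 / B * μ = 2 * (μ / B) := by ring
        linarith
      calc _ ≤ Real.exp (2 * (μ/B)) ^ s := pow_le_pow_left₀ (Finset.sum_nonneg fun z _ => mul_nonneg (hP0 z) (Real.exp_pos _).le) h2 s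
        _ = _ := by rw [← Real.exp_nat_mul]; congr 1; ring
    have h7 : ∑ S : Fin s → α, wt P S * ∑ a, Real.exp ((∑ t, f a (S t)) / B) ≤ K := by
      simp only [Finset.mul_sum]
      rw [Finset.sum_comm]
      refine (Finset.sum_le_sum fun a _ => h1 a).trans (le_of_eq ?_)
      simp [hK, hd]
    have e : ∑ S : Fin s → α, wt P S * (B * (Real.log K + (∑ a, Real.exp ((∑ t, f a (S t)) / B)) / K))
       = B * (Real.log K + (∑ S : Fin s → α, wt P S * ∑ a, Real.exp ((∑ t, f a (S t)) / B)) / K) := by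
      have : ∀ S : Fin s → α, wt P S * (B * (Real.log K + (∑ a, Real.exp ((∑ t, f a (S t)) / B)) / K))
        = (B * Real.log K) * wt P S + B / K * (wt P S * ∑ a, Real.exp ((∑ t, f a (S t)) / B)) := by
        intro S; ring
      simp only [this]
      rw [Finset.sum_add_distrib, ← Finset.mul_sum, ← Finset.mul_sum, sum_wt hP]; ring
    rw [e, ← hlK]
    have := (div_le_one hK0).2 h7
    gcongr

lemma wX {n m : ℕ} (pr : Fin n → ℝ) (pc : Fin m → ℝ) (hr : ∀ i, 0 < pr i) (hc : ∀ j, 0 < pc j)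
    (X : Matrix (Fin n) (Fin m) ℝ) (i : Fin n) (j : Fin m) :
    1 / (√(pr i) * √(pc j)) * (Matrix.diagonal (fun i => Real.sqrt (pr i)) * X *
    Matrix.diagonal (fun j => Real.sqrt (pc j))) i j = X i j := by
  have h1 := Real.sqrt_pos.2 (hr i)
  have h2 := Real.sqrt_pos.2 (hc j)
  rw [mul_diagonal, diagonal_mul]
  field_simp

lemma abs_bound {n m : ℕ} (p : Matrix (Fin n) (Fin m) ℝ) (hp : IsDistrib p)
    (hr : ∀ i, 0 < rowMarg p i) (hc : ∀ j, 0 < colMarg p j) (X : Matrix (Fin n) (Fin m) ℝ) :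
    ∑ i, ∑ j, p i j * |X i j| ≤ wTrNorm (rowMarg p) (colMarg p) X := by
  set Q : Matrix (Fin n) (Fin m) ℝ := fun i j => p i j * SignType.sign (X i j) * (1 / (√(rowMarg p i) * √(colMarg p j))) with hQ
  have h := duality Q (Matrix.diagonal (fun i => Real.sqrt (rowMarg p i)) * X *
    Matrix.diagonal (fun j => Real.sqrt (colMarg p j))) 1 (by
    intro u v
    rw [one_mul]
    have h1 := Real.sum_mul_le_sqrt_mul_sqrt (Finset.univ (α := Fin n × Fin m))
      (fun z => √(p z.1 z.2) * (|u z.1| / √(rowMarg p z.1))) (fun z => √(p z.1 z.2) * (|v z.2| / √(colMarg p z.2)))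
    have e1 : ∑ z : Fin n × Fin m, (√(p z.1 z.2) * (|u z.1| / √(rowMarg p z.1))) ^ 2 = u ⬝ᵥ u := by
      rw [Fintype.sum_prod_type]
      refine Finset.sum_congr rfl fun i _ => ?_
      have : ∀ j, (√(p i j) * (|u i| / √(rowMarg p i))) ^ 2 = p i j * (u i * u i / rowMarg p i) := by
        intro j
        rw [mul_pow, div_pow, Real.sq_sqrt (hp.1 i j), Real.sq_sqrt (hr i).le, sq_abs, pow_two]
      simp only [this]
      rw [← Finset.sum_mul]
      have := (hr i).ne'
      change rowMarg p i * _ = _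
      field_simp
    have e2 : ∑ z : Fin n × Fin m, (√(p z.1 z.2) * (|v z.2| / √(colMarg p z.2))) ^ 2 = v ⬝ᵥ v := by
      rw [Fintype.sum_prod_type_right]
      refine Finset.sum_congr rfl fun j _ => ?_
      have : ∀ i, (√(p i j) * (|v j| / √(colMarg p j))) ^ 2 = p i j * (v j * v j / colMarg p j) := by
        intro i
        rw [mul_pow, div_pow, Real.sq_sqrt (hp.1 i j), Real.sq_sqrt (hc j).le, sq_abs, pow_two]
      simp only [this]
      rw [← Finset.sum_mul]
      have := (hc j).ne'
      change colMarg p j * _ = _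
      field_simp
    rw [e1, e2] at h1
    refine le_trans ?_ h1
    rw [Fintype.sum_prod_type]
    simp only [dotProduct, mulVec, Finset.mul_sum]
    refine Finset.sum_le_sum fun i _ => Finset.sum_le_sum fun j _ => ?_
    have a1 := Real.sqrt_pos.2 (hr i)
    have a2 := Real.sqrt_pos.2 (hc j)
    have a3 := hp.1 i j
    have a4 : |((SignType.sign (X i j) : SignType) : ℝ)| ≤ 1 := by
      cases SignType.sign (X i j) <;> simp
    calc _ ≤ |u i * (Q i j * v j)| := le_abs_self _
      _ = |((SignType.sign (X i j) : SignType) : ℝ)| * (p i j * (|u i| * |v j| * (1 / (√(rowMarg p i) * √(colMarg p j))))) := by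
          simp only [hQ, abs_mul, abs_of_nonneg a3, abs_of_nonneg (show 0 ≤ 1 / (√(rowMarg p i) * √(colMarg p j)) by positivity)]
          ring
      _ ≤ 1 * (p i j * (|u i| * |v j| * (1 / (√(rowMarg p i) * √(colMarg p j))))) := by gcongr
      _ = √(p i j) * √(p i j) * (|u i| * |v j| * (1 / (√(rowMarg p i) * √(colMarg p j)))) := by
          rw [Real.mul_self_sqrt a3, one_mul]
      _ = _ := by field_simp)
  rw [one_mul] at h
  refine le_trans (le_of_eq ?_) h
  refine Finset.sum_congr rfl fun i _ => Finset.sum_congr rfl fun j _ => ?_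
  simp only [hQ]
  rw [mul_assoc, wX _ _ hr hc, mul_assoc, sign_mul_self]

lemma small_case {n m : ℕ} (r l : ℝ) (p : Matrix (Fin n) (Fin m) ℝ) (hp : IsDistrib p)
    (hr : ∀ i, 0 < rowMarg p i) (hc : ∀ j, 0 < colMarg p j) (ℓ : ℝ → ℝ → ℝ) (Y : Matrix (Fin n) (Fin m) ℝ)
    (hl : 0 ≤ l) (hℓ : LipLoss l ℓ) (X X' : Matrix (Fin n) (Fin m) ℝ) (hX : X ∈ Wball (rowMarg p) (colMarg p) r)
    (hX' : X' ∈ Wball (rowMarg p) (colMarg p) r) :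
    popRisk p ℓ Y X ≤ popRisk p ℓ Y X' + 2 * l * √r := by
  have h1 := (abs_bound p hp hr hc X).trans hX
  have h2 := (abs_bound p hp hr hc X').trans hX'
  have h3 : popRisk p ℓ Y X ≤ popRisk p ℓ Y X' + l * (∑ i, ∑ j, p i j * |X i j| + ∑ i, ∑ j, p i j * |X' i j|) := by
    simp only [popRisk, ← Finset.sum_add_distrib, Finset.mul_sum]
    refine Finset.sum_le_sum fun i _ => Finset.sum_le_sum fun j _ => ?_
    have a := (le_abs_self _).trans (hℓ (X i j) (X' i j) (Y i j))
    have b := mul_le_mul_of_nonneg_left (abs_sub (X i j) (X' i j)) hl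
    have := mul_le_mul_of_nonneg_left (a.trans b) (hp.1 i j)
    nlinarith
  have := mul_le_mul_of_nonneg_left (add_le_add h1 h2) hl
  linarith

lemma E_sqrt {Ω : Type*} [Fintype Ω] (w G : Ω → ℝ) (hw : ∀ o, 0 ≤ w o) (hw1 : ∑ o, w o = 1) (hG : ∀ o, 0 ≤ G o)
    (b : ℝ) (hb : 0 < b) (h : ∑ o, w o * G o ≤ b ^ 2) : ∑ o, w o * √(G o) ≤ b := by
  have h1 : ∀ o, w o * √(G o) ≤ (1/(2*b)) * (w o * G o) + b/2 * w o := by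
    intro o
    have : √(G o) ≤ (1/(2*b)) * G o + b/2 := by
      have e := Real.sq_sqrt (hG o)
      have : 0 ≤ (√(G o) - b)^2 / (2*b) := by positivity
      have e2 : (√(G o) - b)^2 / (2*b) = (1/(2*b)) * (√(G o))^2 + b/2 - √(G o) := by field_simp; ring
      rw [e2, e] at this; linarith
    have := mul_le_mul_of_nonneg_left this (hw o)
    linarith
  refine (Finset.sum_le_sum fun o _ => h1 o).trans ?_
  rw [Finset.sum_add_distrib, ← Finset.mul_sum, ← Finset.mul_sum, hw1]
  have := mul_le_mul_of_nonneg_left h (show 0 ≤ 1/(2*b) by positivity)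
  have e : 1/(2*b) * b^2 = b/2 := by field_simp
  linarith

lemma large_core {n m s : ℕ} (r l C : ℝ) (p : Matrix (Fin n) (Fin m) ℝ) (hp : IsDistrib p)
    (hm : 2 ≤ m) (hmn : m ≤ n) (hl : 0 ≤ l) (hs : 1 ≤ s) (hC : 1 ≤ C)
    (hr : ∀ i, 1 / (C * n) ≤ rowMarg p i) (hc : ∀ j, 1 / (C * m) ≤ colMarg p j) (hr1 : 1 ≤ r)
    (hbig : n * Real.log n ≤ s)
    (f : Matrix (Fin n) (Fin m) ℝ → Fin n × Fin m → ℝ)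
    (hf : ∀ X X' z, |f X z - f X' z| ≤ l * |X z.1 z.2 - X' z.1 z.2|)
    (Xhat : (Fin s → Fin n × Fin m) → Matrix (Fin n) (Fin m) ℝ)
    (hX : ∀ S, Xhat S ∈ Wball (rowMarg p) (colMarg p) r) :
    ∑ S, wt (fun z => p z.1 z.2) S * (s * (∑ z : Fin n × Fin m, p z.1 z.2 * f (Xhat S) z) - ∑ t, f (Xhat S) (S t))
      ≤ 68 * C * l * √(r * n * Real.log n * s) := by
  have hn2 : (2:ℝ) ≤ n := by exact_mod_cast hm.trans hmn
  have hm2 : (2:ℝ) ≤ m := by exact_mod_cast hm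
  have hmn' : (m:ℝ) ≤ n := by exact_mod_cast hmn
  have hs' : (1:ℝ) ≤ s := by exact_mod_cast hs
  have hL : 1/2 ≤ Real.log n := by
    have := Real.log_le_log (by norm_num) hn2
    have := Real.log_two_gt_d9
    linarith
  have hrp : ∀ i, 0 < rowMarg p i := fun i => lt_of_lt_of_le (by positivity) (hr i)
  have hcp : ∀ j, 0 < colMarg p j := fun j => lt_of_lt_of_le (by positivity) (hc j)
  set P : Fin n × Fin m → ℝ := fun z => p z.1 z.2 with hPdef
  have hP0 : ∀ z, 0 ≤ P z := fun z => hp.1 _ _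
  have hP1 : ∑ z, P z = 1 := by rw [Fintype.sum_prod_type]; exact hp.2
  set w : Fin n × Fin m → ℝ := fun z => 1 / (√(rowMarg p z.1) * √(colMarg p z.2)) with hw
  have hw2 : ∀ z, w z ^ 2 = 1 / (rowMarg p z.1 * colMarg p z.2) := by
    intro z; simp only [hw]; rw [div_pow, mul_pow, Real.sq_sqrt (hrp _).le, Real.sq_sqrt (hcp _).le, one_pow]
  have hir : ∀ i, 1 / rowMarg p i ≤ C * n := by
    intro i; rw [one_div_le (hrp i) (by positivity)]; exact hr i
  have hic : ∀ j, 1 / colMarg p j ≤ C * n := by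
    intro j
    have : 1 / colMarg p j ≤ C * m := by rw [one_div_le (hcp j) (by positivity)]; exact hc j
    exact this.trans (by gcongr)
  have hC2 : C ≤ C ^ 2 := by nlinarith
  haveI : Nonempty (Fin n ⊕ Fin m) := ⟨Sum.inr ⟨0, by omega⟩⟩
  obtain ⟨G, hG0, hGS, hEG⟩ := chernoff s hP0 hP1 (zz w) (C^2 * n^2) (C^2 * n) (by positivity) (by positivity)
    (by intro a z; unfold zz; positivity)
    (by
      intro a z
      unfold zz
      rw [hw2]
      have h1 : 1 / (rowMarg p z.1 * colMarg p z.2) ≤ C ^ 2 * n ^ 2 := by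
        rw [← one_div_mul_one_div]
        calc _ ≤ (C * n) * (C * n) := mul_le_mul (hir _) (hic _) (by have := hcp z.2; positivity) (by positivity)
          _ = _ := by ring
      have h0 : 0 ≤ 1 / (rowMarg p z.1 * colMarg p z.2) := by have := hcp z.2; have := hrp z.1; positivity
      have h2 : ((if Sum.inl z.1 = a then 1 else 0) + (if Sum.inr z.2 = a then 1 else 0) : ℝ) ≤ 1 := by
        rcases a with a | a
        · simp; split_ifs <;> norm_num
        · simp; split_ifs <;> norm_num
      calc _ ≤ 1 / (rowMarg p z.1 * colMarg p z.2) * 1 := mul_le_mul_of_nonneg_left h2 h0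
        _ ≤ _ := by linarith)
    (by
      intro a
      refine le_trans ?_ (mul_le_mul_of_nonneg_right hC2 (Nat.cast_nonneg n))
      rcases a with a | a
      · rw [Fintype.sum_prod_type, Finset.sum_eq_single a]
        · have : ∀ j, P (a, j) * zz w (Sum.inl a) (a, j) ≤ p a j * (1 / rowMarg p a * (C * n)) := by
            intro j
            unfold zz; rw [hw2]; simp only [hPdef, if_true]
            refine mul_le_mul_of_nonneg_left ?_ (hp.1 a j)
            simp only [reduceCtorEq, if_false, add_zero, mul_one]
            rw [← one_div_mul_one_div]
            exact mul_le_mul_of_nonneg_left (hic j) (by have := hrp a; positivity)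
          refine (Finset.sum_le_sum fun j _ => this j).trans ?_
          rw [← Finset.sum_mul]
          change rowMarg p a * _ ≤ _
          have := (hrp a).ne'
          apply le_of_eq; field_simp
        · intro b _ hb; refine Finset.sum_eq_zero fun j _ => ?_; simp [zz, hb]
        · simp
      · rw [Fintype.sum_prod_type_right, Finset.sum_eq_single a]
        · have : ∀ i, P (i, a) * zz w (Sum.inr a) (i, a) ≤ p i a * (1 / colMarg p a * (C * n)) := by
            intro i
            unfold zz; rw [hw2]; simp only [hPdef, if_true]
            refine mul_le_mul_of_nonneg_left ?_ (hp.1 i a)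
            simp only [reduceCtorEq, if_false, zero_add, mul_one]
            rw [← one_div_mul_one_div, mul_comm]
            exact mul_le_mul_of_nonneg_left (hir i) (by have := hcp a; positivity)
          refine (Finset.sum_le_sum fun j _ => this j).trans ?_
          rw [← Finset.sum_mul]
          change colMarg p a * _ ≤ _
          have := (hcp a).ne'
          apply le_of_eq; field_simp
        · intro b _ hb; refine Finset.sum_eq_zero fun j _ => ?_; simp [zz, hb]
        · simp)
  have hlog2n : Real.log (2 * n) ≤ 2 * Real.log n := by
    rw [Real.log_mul (by norm_num) (by positivity)]
    have := Real.log_le_log (by norm_num) hn2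
    linarith
  have hEG' : ∑ S, wt P S * G S ≤ 6 * C^2 * n * s := by
    refine hEG.trans ?_
    have h1 : Real.log ((Fintype.card (Fin n ⊕ Fin m) : ℕ) : ℝ) ≤ 2 * Real.log n := by
      refine le_trans (Real.log_le_log ?_ ?_) hlog2n
      · simp; positivity
      · simp; linarith
    have h2 : C^2 * (n:ℝ) / (C^2 * n^2) = 1 / n := by field_simp
    rw [h2]
    calc _ ≤ C^2 * (n:ℝ)^2 * (4 * Real.log n + 2 * s * (1/n)) := by
            refine mul_le_mul_of_nonneg_left ?_ (by positivity); linarith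
      _ = C^2 * n * (4 * (n * Real.log n) + 2 * s) := by field_simp
      _ ≤ C^2 * n * (4 * s + 2 * s) := by gcongr
      _ = _ := by ring
  set b := √(6 * C^2 * n * s) with hb
  have hb0 : 0 < b := Real.sqrt_pos.2 (by positivity)
  have hEs : ∑ S, wt P S * √(G S) ≤ b :=
    E_sqrt _ _ (wt_nonneg hP0) (sum_wt hP1) (fun S => (hG0 S).le) b hb0 (by rw [hb, Real.sq_sqrt (by positivity)]; exact hEG')
  set k : ℕ := ⌈Real.log (2 * n)⌉₊ with hk
  have hk1 : Real.log (2 * n) ≤ k := Nat.le_ceil _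
  have hlp : 0 < Real.log (2 * n) := Real.log_pos (by linarith)
  have hk2 : (k:ℝ) ≤ 4 * Real.log n := by
    have := Nat.ceil_lt_add_one hlp.le
    rw [← hk] at this; linarith
  have hk0 : 1 ≤ k := Nat.ceil_pos.2 hlp
  have hnk : (n:ℝ) + m ≤ Real.exp k := by
    have := Real.exp_le_exp.2 hk1
    rw [Real.exp_log (by positivity)] at this; linarith
  have hrad := fun S => rad w S (G S) (hG0 S) (hGS S) k hk0 hnk
  choose M hM0 hMsum hMX using hrad
  haveI : Nonempty (Fin s → Fin n × Fin m) := ⟨fun _ => (⟨0, by omega⟩, ⟨0, by omega⟩)⟩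
  have hsym := symm_lemma (s := s) hP0 hP1 (fun S z => f (Xhat S) z) id
  have hin : ∀ S : Fin s → Fin n × Fin m, ∑ ε : Fin s → Bool, mx (fun i => ∑ t, sg (ε t) * f (Xhat i) (S t)) ≤
      l * √r * (2 ^ s * (2 * √(12 * k * G S))) := by
    intro S
    have h1 := contraction l s (fun t i => f (Xhat i) (S t)) (fun t i => Xhat i (S t).1 (S t).2)
      (fun t x y => hf _ _ _) (fun _ => 0)
    simp only [zero_add] at h1
    refine h1.trans ?_
    have h2 : ∀ ε, mx (fun i => l * ∑ t, sg (ε t) * Xhat i (S t).1 (S t).2) ≤ l * √r * M S ε := by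
      intro ε
      refine mx_le _ _ fun i => ?_
      have h3 := hMX S ε (Matrix.diagonal (fun i => Real.sqrt (rowMarg p i)) * Xhat i *
        Matrix.diagonal (fun j => Real.sqrt (colMarg p j)))
      simp only [hw, wX _ _ hrp hcp] at h3
      have h4 := h3.trans (mul_le_mul_of_nonneg_left (hX i) (hM0 S ε))
      have := mul_le_mul_of_nonneg_left h4 hl
      linarith
    refine (Finset.sum_le_sum fun ε _ => h2 ε).trans ?_
    rw [← Finset.mul_sum]
    exact mul_le_mul_of_nonneg_left (hMsum S) (by positivity)
  have h5 : ∑ S : Fin s → Fin n × Fin m, wt P S * ∑ ε : Fin s → Bool, mx (fun i => ∑ t, sg (ε t) * f (Xhat i) (S t))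
     ≤ 2 ^ s * (2 * l * √r * √(12 * k) * b) := by
    calc _ ≤ ∑ S, wt P S * (l * √r * (2 ^ s * (2 * √(12 * k * G S)))) :=
          Finset.sum_le_sum fun S _ => mul_le_mul_of_nonneg_left (hin S) (wt_nonneg hP0 S)
      _ = 2 ^ s * (2 * l * √r * √(12 * k) * ∑ S, wt P S * √(G S)) := by
          simp only [Finset.mul_sum]
          refine Finset.sum_congr rfl fun S _ => ?_
          rw [Real.sqrt_mul (by positivity)]; ring
      _ ≤ _ := by gcongr
  have h6 := hsym.trans (mul_le_mul_of_nonneg_left h5 (by norm_num : (0:ℝ) ≤ 2))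
  have h7 : √r * √(12 * k) * b ≤ 17 * C * √(r * n * Real.log n * s) := by
    rw [hb, ← Real.sqrt_mul (by positivity), ← Real.sqrt_mul (by positivity)]
    rw [Real.sqrt_le_left (by positivity), mul_pow, Real.sq_sqrt (by positivity)]
    calc r * (12 * k) * (6 * C^2 * n * s) ≤ r * (12 * (4 * Real.log n)) * (6 * C^2 * n * s) := by gcongr
      _ = 288 * (C^2 * (r * n * Real.log n * s)) := by ring
      _ ≤ 289 * (C^2 * (r * n * Real.log n * s)) := by gcongr; norm_num
      _ = _ := by ring
  have h8 : (0:ℝ) < 2 ^ s := by positivity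
  simp only [id] at h6
  have h9 : ∑ S, wt P S * (s * (∑ z : Fin n × Fin m, P z * f (Xhat S) z) - ∑ t, f (Xhat S) (S t)) ≤ 4 * l * (√r * √(12 * k) * b) := by
    refine le_of_mul_le_mul_left ?_ h8
    refine h6.trans (le_of_eq ?_); ring
  refine h9.trans ((mul_le_mul_of_nonneg_left h7 (by positivity)).trans (le_of_eq ?_))
  ring

/-- if the marginals of the sampling distribution are lower-bounded,
`p^r(i) ≥ 1/(C n)` and `p^c(j) ≥ 1/(C m)`, then any empirical risk minimizer over the
`p`-weighted trace-norm ball satisfies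
`E_S[L_p(X̂_S)] ≤ inf_{X ∈ W_p} L_p(X) + C'·C·l·√(r n log n / s)`. -/
theorem weighted_traceNorm_lower_bounded_marginals :
    ∃ C' : ℝ, 0 < C' ∧
      ∀ (n m s : ℕ) (r l C : ℝ) (p : Matrix (Fin n) (Fin m) ℝ)
        (ℓ : ℝ → ℝ → ℝ) (Y : Matrix (Fin n) (Fin m) ℝ)
        (Xhat : (Fin s → Fin n × Fin m) → Matrix (Fin n) (Fin m) ℝ),
        2 ≤ m → m ≤ n → 1 ≤ r → 0 ≤ l → 1 ≤ s → 1 ≤ C →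
        IsDistrib p →
        (∀ i, 1 / (C * n) ≤ rowMarg p i) →
        (∀ j, 1 / (C * m) ≤ colMarg p j) →
        LipLoss l ℓ →
        (∀ S, Xhat S ∈ Wball (rowMarg p) (colMarg p) r ∧
          ∀ X ∈ Wball (rowMarg p) (colMarg p) r,
            empRisk ℓ Y S (Xhat S) ≤ empRisk ℓ Y S X) →
        Esample s p (fun S => popRisk p ℓ Y (Xhat S)) ≤
          sInf ((fun X => popRisk p ℓ Y X) '' Wball (rowMarg p) (colMarg p) r) +
            C' * C * l * Real.sqrt (r * n * Real.log n / s) := by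
  refine ⟨68, by norm_num, ?_⟩
  intro n m s r l C p ℓ Y Xhat hm hmn hr1 hl hs hC hp hr hc hℓ hX
  have hn2 : (2:ℝ) ≤ n := by exact_mod_cast hm.trans hmn
  have hm2 : (2:ℝ) ≤ m := by exact_mod_cast hm
  have hs' : (1:ℝ) ≤ s := by exact_mod_cast hs
  have hL : 1/2 ≤ Real.log n := by
    have := Real.log_le_log (by norm_num) hn2
    have := Real.log_two_gt_d9
    linarith
  have hrp : ∀ i, 0 < rowMarg p i := fun i => lt_of_lt_of_le (by positivity) (hr i)
  have hcp : ∀ j, 0 < colMarg p j := fun j => lt_of_lt_of_le (by positivity) (hc j)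
  have hP0 : ∀ z : Fin n × Fin m, 0 ≤ p z.1 z.2 := fun z => hp.1 _ _
  have hP1 : ∑ z : Fin n × Fin m, p z.1 z.2 = 1 := by rw [Fintype.sum_prod_type]; exact hp.2
  have hw0 : ∀ S : Fin s → Fin n × Fin m, 0 ≤ sampleProb p S := fun S => wt_nonneg hP0 S
  have hw1 : ∑ S : Fin s → Fin n × Fin m, sampleProb p S = 1 := sum_wt (s := s) hP1
  rw [← sub_le_iff_le_add]
  refine le_csInf ⟨_, Xhat (fun _ => (⟨0, by omega⟩, ⟨0, by omega⟩)), (hX _).1, rfl⟩ ?_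
  rintro _ ⟨X, hXW, rfl⟩
  rw [sub_le_iff_le_add]
  simp only
  rcases le_or_gt (n * Real.log n) s with hbig | hsmall
  · have h1 := large_core r l C p hp hm hmn hl hs hC hr hc hr1 hbig
      (fun X z => ℓ (X z.1 z.2) (Y z.1 z.2)) (fun X X' z => hℓ _ _ _) Xhat (fun S => (hX S).1)
    have hpop : ∀ X : Matrix (Fin n) (Fin m) ℝ, ∑ z : Fin n × Fin m, p z.1 z.2 * ℓ (X z.1 z.2) (Y z.1 z.2) = popRisk p ℓ Y X := by
      intro X; rw [Fintype.sum_prod_type]; rfl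
    simp only [hpop] at h1
    have h2 : ∀ S : Fin s → Fin n × Fin m, ∑ t, ℓ (Xhat S (S t).1 (S t).2) (Y (S t).1 (S t).2) ≤
        ∑ t, ℓ (X (S t).1 (S t).2) (Y (S t).1 (S t).2) := by
      intro S
      exact le_of_mul_le_mul_left ((hX S).2 X hXW) (by positivity)
    have h3 : ∑ S : Fin s → Fin n × Fin m, sampleProb p S * ∑ t, ℓ (X (S t).1 (S t).2) (Y (S t).1 (S t).2)
        = s * popRisk p ℓ Y X := by
      simp only [Finset.mul_sum]
      rw [Finset.sum_comm]
      have : ∀ t, ∑ S : Fin s → Fin n × Fin m, sampleProb p S * ℓ (X (S t).1 (S t).2) (Y (S t).1 (S t).2) = popRisk p ℓ Y X := by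
        intro t
        rw [← hpop]
        exact sum_wt_apply hP1 (fun z => ℓ (X z.1 z.2) (Y z.1 z.2)) t
      simp [this]
    have h4 : s * Esample s p (fun S => popRisk p ℓ Y (Xhat S)) - s * popRisk p ℓ Y X ≤ 68 * C * l * √(r * n * Real.log n * s) := by
      refine le_trans ?_ h1
      rw [← h3, Esample, Finset.mul_sum, ← Finset.sum_sub_distrib]
      refine Finset.sum_le_sum fun S _ => ?_
      change _ ≤ sampleProb p S * _
      have := mul_le_mul_of_nonneg_left (h2 S) (hw0 S)
      rw [mul_sub]; linarith
    have h5 : √(r * n * Real.log n * s) = s * √(r * n * Real.log n / s) := by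
      rw [show r * n * Real.log n * s = (s:ℝ)^2 * (r * n * Real.log n / s) by field_simp,
        Real.sqrt_mul (by positivity), Real.sqrt_sq (by positivity)]
    rw [h5] at h4
    have hs0 : (0:ℝ) < s := by linarith
    refine le_of_mul_le_mul_left ?_ hs0
    linarith
  · have h1 : √r ≤ √(r * n * Real.log n / s) := by
      refine Real.sqrt_le_sqrt ?_
      rw [le_div_iff₀ (by positivity), mul_assoc]
      gcongr
    have h2 : Esample s p (fun S => popRisk p ℓ Y (Xhat S)) ≤ popRisk p ℓ Y X + 2 * l * √r := by
      unfold Esample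
      calc _ ≤ ∑ S : Fin s → Fin n × Fin m, sampleProb p S * (popRisk p ℓ Y X + 2 * l * √r) :=
            Finset.sum_le_sum fun S _ => mul_le_mul_of_nonneg_left
              (small_case r l p hp hrp hcp ℓ Y hl hℓ (Xhat S) X (hX S).1 hXW) (hw0 S)
        _ = _ := by rw [← Finset.sum_mul, hw1, one_mul]
    refine h2.trans ?_
    have h3 : 2 * l * √r ≤ 68 * C * l * √(r * n * Real.log n / s) := by
      calc 2 * l * √r ≤ (68 * C * l) * √r := by
            refine mul_le_mul_of_nonneg_right ?_ (Real.sqrt_nonneg _); nlinarith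
        _ ≤ _ := by gcongr
    linarith

end
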